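/- arXiv:1112.3285 — 2 statements merged into one kernel-verified Lean document; each statement's English description precedes it below -/
import Mathlib

section
/- For every θ > 0 and all Schwartz functions f, g : ℝ² → ℂ, the function x ↦ (πθ)⁻² ∬_{ℝ²×ℝ²} f(x+y) g(x+z) e^{−2i y·Θ⁻¹z} dy dz is again a Schwartz function on ℝ², and the resulting product ⋆ is associative: (f ⋆ g) ⋆ h = f ⋆ (g ⋆ h) for all Schwartz f, g, h : ℝ² → ℂ. -/
open MeasureTheory Complex

noncomputable section

abbrev E2 := EuclideanSpace ℝ (Fin 2)

/-- The Moyal star product of two functions on ℝ², with deformation parameter θ: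
`(f ⋆ g)(x) = (πθ)⁻² ∬ f(x+y) g(x+z) e^{−2i y·Θ⁻¹z} dy dz` where
`y·Θ⁻¹z = (y₂z₁ − y₁z₂)/θ`. -/
def moyal (θ : ℝ) (f g : E2 → ℂ) : E2 → ℂ := fun x =>
  (((Real.pi * θ) ^ 2)⁻¹ : ℝ) • ∫ y : E2, ∫ z : E2,
    f (x + y) * g (x + z) *
      Complex.exp (-(2 * Complex.I) * ((((y 1) * (z 0) - (y 0) * (z 1)) / θ : ℝ) : ℂ))

open scoped SchwartzMap FourierTransform RealInnerProductSpace ContDiff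

section TwistedConvolution

variable {E V W U : Type} [NormedAddCommGroup E] [InnerProductSpace ℝ E]
  [NormedAddCommGroup V] [NormedSpace ℝ V] [NormedAddCommGroup W] [NormedSpace ℝ W]
  [NormedAddCommGroup U] [NormedSpace ℂ U] [NormedSpace ℝ U]

variable (B : E →L[ℝ] E →L[ℝ] ℝ) (M : V →L[ℝ] W →L[ℝ] U) (a : 𝓢(E, V)) (b : 𝓢(E, W))

lemma continuous_twistedConv_integrand :
    Continuous fun p : E × E => 𝐞 (B p.1 p.2) • M (a (p.1 - p.2)) (b p.2) := by
  have := Real.continuous_fourierChar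
  have := a.continuous
  have := b.continuous
  fun_prop

lemma exists_norm_twistedConv_integrand_le (k : ℕ) :
    ∃ C, ∀ v w, ‖v - w‖ ^ k * ‖𝐞 (B v w) • M (a (v - w)) (b w)‖ ≤ C * ‖b w‖ := by
  refine ⟨‖M‖ * SchwartzMap.seminorm ℝ k 0 a, fun v w => ?_⟩
  rw [Circle.norm_smul]
  calc ‖v - w‖ ^ k * ‖M (a (v - w)) (b w)‖
      ≤ ‖v - w‖ ^ k * (‖M‖ * ‖a (v - w)‖ * ‖b w‖) := by
        gcongr
        exact M.le_opNorm₂ _ _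
    _ = ‖M‖ * (‖v - w‖ ^ k * ‖a (v - w)‖) * ‖b w‖ := by ring
    _ ≤ _ := by
        gcongr
        exact a.norm_pow_mul_le_seminorm ℝ k _

variable [IsScalarTower ℝ ℂ U] [FiniteDimensional ℝ E] [MeasurableSpace E] [BorelSpace E]

/-- The convolution of `a` and `b` along the bilinear map `M`, twisted by the character
`e^{2πi B(v, w)}`. -/
def twistedConv (B : E →L[ℝ] E →L[ℝ] ℝ) (M : V →L[ℝ] W →L[ℝ] U) (a : E → V) (b : E → W) : E → U :=
  fun v => ∫ w, 𝐞 (B v w) • M (a (v - w)) (b w)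

lemma integrable_twistedConv_integrand (v : E) :
    Integrable fun w => 𝐞 (B v w) • M (a (v - w)) (b w) := by
  obtain ⟨C, hC⟩ := exists_norm_twistedConv_integrand_le B M a b 0
  exact (b.integrable.norm.const_mul C).mono'
    ((continuous_twistedConv_integrand B M a b).comp
      (Continuous.prodMk_right v)).aestronglyMeasurable (.of_forall fun w => by simpa using hC v w)

/-- The second bilinear map in the Leibniz rule for the twisted convolution; it pairs `a` with
`w ↦ B(·, w) b(w)`. -/
def twistedPrecompR : V →L[ℝ] (E →L[ℝ] W) →L[ℝ] (E →L[ℝ] U) :=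
  (2 * Real.pi * I : ℂ) • M.precompR E

lemma hasFDerivAt_twistedConv (v : E) :
    HasFDerivAt (twistedConv B M a b)
      (twistedConv B (M.precompL E) (SchwartzMap.fderivCLM ℝ E V a) b v +
        twistedConv B (twistedPrecompR M) a (SchwartzMap.smulRightCLM ℝ W B.flip b) v) v := by
  have h1 := integrable_twistedConv_integrand B (M.precompL E) (SchwartzMap.fderivCLM ℝ E V a) b
  have h2 := integrable_twistedConv_integrand B (twistedPrecompR M) a
    (SchwartzMap.smulRightCLM ℝ W B.flip b)
  obtain ⟨C₁, hC₁⟩ := exists_norm_twistedConv_integrand_le B (M.precompL E)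
    (SchwartzMap.fderivCLM ℝ E V a) b 0
  obtain ⟨C₂, hC₂⟩ := exists_norm_twistedConv_integrand_le B (twistedPrecompR M) a
    (SchwartzMap.smulRightCLM ℝ W B.flip b) 0
  simp only [pow_zero, one_mul] at hC₁ hC₂
  rw [twistedConv, twistedConv, ← integral_add (h1 v) (h2 v)]
  refine hasFDerivAt_integral_of_dominated_of_fderiv_le
    (F' := fun v w => 𝐞 (B v w) • M.precompL E (SchwartzMap.fderivCLM ℝ E V a (v - w)) (b w) +
      𝐞 (B v w) • twistedPrecompR M (a (v - w)) (SchwartzMap.smulRightCLM ℝ W B.flip b w))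
    (bound := fun w => C₁ * ‖b w‖ + C₂ * ‖SchwartzMap.smulRightCLM ℝ W B.flip b w‖)
    Filter.univ_mem (.of_forall fun x =>
      (integrable_twistedConv_integrand B M a b x).aestronglyMeasurable)
    (integrable_twistedConv_integrand B M a b v) ((h1 v).add (h2 v)).aestronglyMeasurable
    (.of_forall fun w x _ => (norm_add_le _ _).trans (add_le_add (hC₁ x w) (hC₂ x w)))
    ((b.integrable.norm.const_mul _).add ((SchwartzMap.integrable _).norm.const_mul _))
    (.of_forall fun w x _ => ?_)
  have hphase := (Real.hasDerivAt_fourierChar (B.flip w x)).hasFDerivAt.comp x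
    (B.flip w).hasFDerivAt
  have ha := (a.hasFDerivAt (x - w)).comp x ((hasFDerivAt_id x).sub_const w)
  have hM := ((M.flip (b w)).hasFDerivAt (x := a (x - w))).comp x ha
  refine (hphase.smul hM).congr_fderiv ?_
  ext u
  simp only [twistedPrecompR, Circle.smul_def, smul_smul, add_apply, smul_apply]
  simp
  rw [← algebraMap_smul ℂ (B u w), smul_smul]
  congr 1
  simp only [coe_algebraMap]
  ring

lemma contDiff_twistedConv (n : ℕ) :
    ContDiff ℝ n (twistedConv B M a b) := by
  induction n generalizing V W U with
  | zero =>
    exact contDiff_zero.2 (continuous_iff_continuousAt.2 fun v =>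
      (hasFDerivAt_twistedConv B M a b v).continuousAt)
  | succ n ih =>
    exact contDiff_succ_iff_hasFDerivAt.2
      ⟨_, (ih _ _ _).add (ih _ _ _), hasFDerivAt_twistedConv B M a b⟩

lemma twistedConv_decay (k : ℕ) :
    ∃ C, ∀ v, ‖v‖ ^ k * ‖twistedConv B M a b v‖ ≤ C := by
  obtain ⟨C₁, hC₁⟩ := exists_norm_twistedConv_integrand_le B M a b k
  obtain ⟨C₂, hC₂⟩ := exists_norm_twistedConv_integrand_le B M a b 0
  simp only [pow_zero, one_mul] at hC₂
  refine ⟨∫ w, 2 ^ (k - 1) * (C₁ * ‖b w‖ + C₂ * (‖w‖ ^ k * ‖b w‖)), fun v => ?_⟩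
  rw [← norm_norm v, ← norm_pow, ← norm_smul, twistedConv, ← integral_smul]
  refine norm_integral_le_of_norm_le (((b.integrable.norm.const_mul _).add
    ((b.integrable_pow_mul volume k).const_mul _)).const_mul _) (.of_forall fun w => ?_)
  rw [norm_smul, norm_pow, norm_norm]
  have hv : ‖v‖ ^ k ≤ 2 ^ (k - 1) * (‖v - w‖ ^ k + ‖w‖ ^ k) :=
    (pow_le_pow_left₀ (norm_nonneg v) (by simpa using norm_add_le (v - w) w) k).trans
      (add_pow_le (norm_nonneg _) (norm_nonneg _) k)
  refine (mul_le_mul_of_nonneg_right hv (norm_nonneg _)).trans ?_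
  rw [mul_assoc, add_mul]
  refine mul_le_mul_of_nonneg_left (add_le_add (hC₁ v w) ?_) (by positivity)
  rw [mul_left_comm C₂]
  exact mul_le_mul_of_nonneg_left (hC₂ v w) (by positivity)

lemma twistedConv_iteratedFDeriv_decay (k n : ℕ) :
    ∃ C, ∀ v, ‖v‖ ^ k * ‖iteratedFDeriv ℝ n (twistedConv B M a b) v‖ ≤ C := by
  induction n generalizing V W U with
  | zero => simpa using twistedConv_decay B M a b k
  | succ n ih =>
    obtain ⟨C₁, h₁⟩ := ih (M.precompL E) (SchwartzMap.fderivCLM ℝ E V a) b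
    obtain ⟨C₂, h₂⟩ := ih (twistedPrecompR M) a (SchwartzMap.smulRightCLM ℝ W B.flip b)
    refine ⟨C₁ + C₂, fun v => ?_⟩
    have hfderiv : fderiv ℝ (twistedConv B M a b) =
        twistedConv B (M.precompL E) (SchwartzMap.fderivCLM ℝ E V a) b +
          twistedConv B (twistedPrecompR M) a (SchwartzMap.smulRightCLM ℝ W B.flip b) :=
      funext fun v => (hasFDerivAt_twistedConv B M a b v).fderiv
    rw [← norm_iteratedFDeriv_fderiv, hfderiv, iteratedFDeriv_add
      (contDiff_twistedConv _ _ _ _ n) (contDiff_twistedConv _ _ _ _ n)]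
    calc _ ≤ ‖v‖ ^ k * (_ + _) := by gcongr; exact norm_add_le _ _
      _ ≤ C₁ + C₂ := by rw [mul_add]; exact add_le_add (h₁ v) (h₂ v)

/-- The twisted convolution of two Schwartz functions, as a Schwartz function. -/
def SchwartzMap.twistedConv : 𝓢(E, U) where
  toFun := _root_.twistedConv B M a b
  smooth' := contDiff_infty.2 (contDiff_twistedConv B M a b)
  decay' := twistedConv_iteratedFDeriv_decay B M a b

open ContinuousLinearMap in
lemma twistedConv_mul_assoc (hB : ∀ v w, B v w = -B w v) (a b c : 𝓢(E, ℂ)) :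
    twistedConv B (mul ℝ ℂ) (twistedConv B (mul ℝ ℂ) a b) c =
      twistedConv B (mul ℝ ℂ) a (twistedConv B (mul ℝ ℂ) b c) := by
  have hB₀ (w : E) : B w w = 0 := by linarith [hB w w]
  ext v
  have hl (w : E) : 𝐞 (B v w) • (twistedConv B (mul ℝ ℂ) a b (v - w) * c w) =
      ∫ s, 𝐞 (B v s + B s w) • (a (v - s) * (b (s - w) * c w)) := by
    rw [twistedConv, ← integral_sub_right_eq_self _ w, ← integral_mul_const, Circle.smul_def,
      smul_eq_mul, ← integral_const_mul]
    refine integral_congr_ae (.of_forall fun s => ?_)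
    have hphase : B v s + B s w = B v w + B (v - w) (s - w) := by
      simp only [map_sub, sub_apply, hB w s, hB₀]
      ring
    simp only [hphase, AddChar.map_add_eq_mul, Circle.smul_def, Circle.coe_mul, smul_eq_mul,
      mul_apply', sub_sub_sub_cancel_right]
    ring
  have hr (s : E) : 𝐞 (B v s) • (a (v - s) * twistedConv B (mul ℝ ℂ) b c s) =
      ∫ w, 𝐞 (B v s + B s w) • (a (v - s) * (b (s - w) * c w)) := by
    rw [twistedConv, ← integral_const_mul, Circle.smul_def, smul_eq_mul, ← integral_const_mul]
    refine integral_congr_ae (.of_forall fun w => ?_)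
    simp only [AddChar.map_add_eq_mul, Circle.smul_def, Circle.coe_mul, smul_eq_mul, mul_apply']
    ring
  have hint : Integrable (fun p : E × E =>
      𝐞 (B v p.2 + B p.2 p.1) • (a (v - p.2) * (b (p.2 - p.1) * c p.1)))
      ((volume : Measure E).prod volume) := by
    refine ((c.integrable.convolution_integrand (mul ℝ ℂ) b.integrable).swap.norm.const_mul
      (SchwartzMap.seminorm ℝ 0 0 a)).mono' (Continuous.aestronglyMeasurable ?_)
      (.of_forall fun p => ?_)
    · have := Real.continuous_fourierChar
      have := a.continuous
      have := b.continuous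
      have := c.continuous
      fun_prop
    · rw [Circle.norm_smul, norm_mul, mul_comm (b _)]
      exact mul_le_mul_of_nonneg_right (a.norm_le_seminorm ℝ _) (norm_nonneg _)
  calc ∫ w, 𝐞 (B v w) • (twistedConv B (mul ℝ ℂ) a b (v - w) * c w)
      = ∫ w, ∫ s, 𝐞 (B v s + B s w) • (a (v - s) * (b (s - w) * c w)) := by simp_rw [hl]
    _ = ∫ s, ∫ w, 𝐞 (B v s + B s w) • (a (v - s) * (b (s - w) * c w)) :=
        integral_integral_swap hint
    _ = ∫ s, 𝐞 (B v s) • (a (v - s) * twistedConv B (mul ℝ ℂ) b c s) := by simp_rw [hr]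

/-- Fourier-side form of the product `f ⋆ g`: the inverse Fourier transform of a twisted convolution
of `𝓕 f` and `b`, where `B(v, w) = ⟪v, K w⟫`. -/
lemma fourierInv_twistedConv_fourier (K : E →L[ℝ] E) (hB : ∀ v w, B v w = ⟪v, K w⟫)
    (hB₀ : ∀ w, B w w = 0) (f b : 𝓢(E, ℂ)) (x : E) :
    𝓕⁻ (twistedConv B (ContinuousLinearMap.mul ℝ ℂ) ⇑(𝓕 f : 𝓢(E, ℂ)) b) x =
      ∫ w, f (x + K w) * (𝐞 ⟪w, x⟫ • b w) := by
  have hf (w : E) : f (x + K w) * (𝐞 ⟪w, x⟫ • b w) =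
      ∫ v, 𝐞 (⟪v, x⟫ + B v w) • ((𝓕 f : 𝓢(E, ℂ)) (v - w) * b w) := by
    have hinv : f (x + K w) = 𝓕⁻ ⇑(𝓕 f : 𝓢(E, ℂ)) (x + K w) := by
      rw [← SchwartzMap.fourierInv_coe, FourierTransform.fourierInv_fourier_eq]
    rw [hinv, Real.fourierInv_eq, ← integral_sub_right_eq_self _ w, ← integral_mul_const]
    refine integral_congr_ae (.of_forall fun v => ?_)
    have hphase : ⟪v, x⟫ + B v w = ⟪v - w, x + K w⟫ + ⟪w, x⟫ := by
      have := hB₀ w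
      rw [hB] at this ⊢
      simp only [inner_sub_left, inner_add_right, this]
      ring
    simp only [hphase, AddChar.map_add_eq_mul, Circle.smul_def, Circle.coe_mul, smul_eq_mul]
    ring
  have hint : Integrable (fun p : E × E => 𝐞 (⟪p.1, x⟫ + B p.1 p.2) • ((𝓕 f : 𝓢(E, ℂ)) (p.1 - p.2) * b p.2))
      ((volume : Measure E).prod volume) := by
    refine ((b.integrable.convolution_integrand (ContinuousLinearMap.mul ℝ ℂ)
      (𝓕 f : 𝓢(E, ℂ)).integrable).norm).mono' (Continuous.aestronglyMeasurable ?_)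
      (.of_forall fun p => ?_)
    · have := Real.continuous_fourierChar
      have := (𝓕 f : 𝓢(E, ℂ)).continuous
      have := b.continuous
      fun_prop
    · rw [Circle.norm_smul, mul_comm]
      rfl
  simp_rw [hf, Real.fourierInv_eq]
  rw [← integral_integral_swap hint]
  refine integral_congr_ae (.of_forall fun v => ?_)
  beta_reduce
  rw [twistedConv, Circle.smul_def, smul_eq_mul, ← integral_const_mul]
  refine integral_congr_ae (.of_forall fun w => ?_)
  simp only [AddChar.map_add_eq_mul, Circle.smul_def, Circle.coe_mul, smul_eq_mul, mul_assoc,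
    ContinuousLinearMap.mul_apply']

end TwistedConvolution

section Moyal

/-- The rotation `(w₀, w₁) ↦ (-w₁, w₀)` of the plane. -/
def quarterTurn : E2 ≃ₗᵢ[ℝ] E2 where
  toFun w := !₂[-w 1, w 0]
  invFun w := !₂[w 1, -w 0]
  map_add' v w := by ext i; fin_cases i <;> simp [add_comm]
  map_smul' c w := by ext i; fin_cases i <;> simp
  left_inv w := by ext i; fin_cases i <;> simp
  right_inv w := by ext i; fin_cases i <;> simp
  norm_map' w := by simp [EuclideanSpace.norm_eq, Fin.sum_univ_two, add_comm]

@[simp] lemma quarterTurn_apply_zero (w : E2) : quarterTurn w 0 = -w 1 := rfl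

@[simp] lemma quarterTurn_apply_one (w : E2) : quarterTurn w 1 = w 0 := rfl

/-- The linear map `Θ` scaled by `π`, with the sign convention of `moyal`. -/
def moyalMap (θ : ℝ) : E2 →L[ℝ] E2 :=
  (Real.pi * θ) • (quarterTurn.toContinuousLinearEquiv : E2 →L[ℝ] E2)

/-- The alternating form `⟪v, moyalMap θ w⟫`. -/
def moyalForm (θ : ℝ) : E2 →L[ℝ] E2 →L[ℝ] ℝ :=
  -((innerSL ℝ).comp (moyalMap θ))

lemma moyalForm_apply (θ : ℝ) (v w : E2) :
    moyalForm θ v w = Real.pi * θ * (v 1 * w 0 - v 0 * w 1) := by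
  simp [moyalForm, moyalMap, PiLp.inner_apply, Fin.sum_univ_two]
  ring

lemma moyalForm_eq_inner (θ : ℝ) (v w : E2) : moyalForm θ v w = ⟪v, moyalMap θ w⟫ := by
  rw [moyalForm_apply]
  simp [moyalMap, PiLp.inner_apply, Fin.sum_univ_two]
  ring

lemma moyalForm_antisymm (θ : ℝ) (v w : E2) : moyalForm θ v w = -moyalForm θ w v := by
  simp only [moyalForm_apply]
  ring

lemma moyalForm_self (θ : ℝ) (w : E2) : moyalForm θ w w = 0 := by
  simp only [moyalForm_apply]
  ring

lemma integral_comp_moyalMap {θ : ℝ} (hθ : 0 < θ) (F : E2 → ℂ) :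
    ∫ y, F y = (Real.pi * θ) ^ 2 • ∫ w, F (moyalMap θ w) := by
  have hc : 0 < Real.pi * θ := mul_pos Real.pi_pos hθ
  have h := quarterTurn.measurePreserving.integral_comp
    quarterTurn.toHomeomorph.measurableEmbedding fun y => F ((Real.pi * θ) • y)
  change _ = _ • ∫ w, F ((Real.pi * θ) • quarterTurn w)
  rw [h, Measure.integral_comp_smul, finrank_euclideanSpace_fin, abs_of_pos (by positivity),
    smul_inv_smul₀ (by positivity)]

lemma moyal_eq_integral_fourier {θ : ℝ} (hθ : 0 < θ) (f g : E2 → ℂ) (x : E2) :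
    moyal θ f g x = ∫ w, f (x + moyalMap θ w) * (𝐞 ⟪w, x⟫ • 𝓕 g w) := by
  have hc : Real.pi * θ ≠ 0 := (mul_pos Real.pi_pos hθ).ne'
  rw [moyal, integral_comp_moyalMap hθ, inv_smul_smul₀ (pow_ne_zero 2 hc)]
  refine integral_congr_ae (.of_forall fun w => ?_)
  beta_reduce
  rw [Real.fourier_eq, ← integral_add_left_eq_self (fun z => 𝐞 (-⟪z, w⟫) • g z) x,
    Circle.smul_def, smul_eq_mul, ← integral_const_mul, ← integral_const_mul]
  refine integral_congr_ae (.of_forall fun z => ?_)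
  have hphase : cexp (-(2 * I) *
      (((moyalMap θ w 1 * z 0 - moyalMap θ w 0 * z 1) / θ : ℝ) : ℂ)) =
        𝐞 (⟪w, x⟫ + -⟪x + z, w⟫) := by
    rw [Real.fourierChar_apply]
    have : (moyalMap θ w 1 * z 0 - moyalMap θ w 0 * z 1) / θ = Real.pi * ⟪z, w⟫ := by
      simp [moyalMap, PiLp.inner_apply, Fin.sum_univ_two]
      field_simp
    rw [this, inner_add_left, real_inner_comm x w]
    congr 1
    push_cast
    ring
  simp only [hphase, AddChar.map_add_eq_mul, Circle.smul_def, Circle.coe_mul, smul_eq_mul]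
  ring

lemma moyal_eq_fourierInv {θ : ℝ} (hθ : 0 < θ) (f g : 𝓢(E2, ℂ)) :
    moyal θ f g =
      𝓕⁻ (SchwartzMap.twistedConv (moyalForm θ) (ContinuousLinearMap.mul ℝ ℂ) (𝓕 f) (𝓕 g)) := by
  ext x
  rw [moyal_eq_integral_fourier hθ, SchwartzMap.fourierInv_coe, ← SchwartzMap.fourier_coe]
  exact (fourierInv_twistedConv_fourier (moyalForm θ) (moyalMap θ) (moyalForm_eq_inner θ)
    (moyalForm_self θ) f (𝓕 g) x).symm

end Moyal

/-- The Moyal product of two Schwartz functions is again a Schwartz function,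
and the Moyal product is associative. -/
theorem moyal_schwartz_and_assoc (θ : ℝ) (hθ : 0 < θ) :
    (∀ f g : SchwartzMap E2 ℂ, ∃ h : SchwartzMap E2 ℂ, ⇑h = moyal θ (⇑f) (⇑g)) ∧
    (∀ f g h : SchwartzMap E2 ℂ,
      moyal θ (moyal θ (⇑f) (⇑g)) (⇑h) = moyal θ (⇑f) (moyal θ (⇑g) (⇑h))) := by
  refine ⟨fun f g => ⟨_, (moyal_eq_fourierInv hθ f g).symm⟩, fun f g h => ?_⟩
  rw [moyal_eq_fourierInv hθ f g, moyal_eq_fourierInv hθ g h, moyal_eq_fourierInv hθ,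
    moyal_eq_fourierInv hθ]
  congr 2
  simp only [FourierTransform.fourier_fourierInv_eq]
  exact DFunLike.coe_injective
    (twistedConv_mul_assoc (moyalForm θ) (moyalForm_antisymm θ) (𝓕 f) (𝓕 g) (𝓕 h))

end
end

section
/- For every θ > 0, every Ω ∈ (0,1] and every Schwartz function a : ℝ² → ℂ, the Lipschitz seminorm of a for the harmonic Dirac operator D₁ equals √(1+Ω²) times that for the standard Dirac operator D₀: sup_{Ψ ≠ 0} ‖Σ_{μ=1,2} Γ^μ((∂_μ a) ⋆ Ψ)‖_{L²(ℝ²,ℂ⁴)} / ‖Ψ‖_{L²(ℝ²,ℂ⁴)} = √(1+Ω²) · sup_{Ψ' ≠ 0} ‖Σ_{μ=1,2} σ^μ((∂_μ a) ⋆ Ψ')‖_{L²(ℝ²,ℂ²)} / ‖Ψ'‖_{L²(ℝ²,ℂ²)}, where Ψ ranges over nonzero Schwartz functions ℝ² → ℂ⁴, Ψ' over nonzero Schwartz functions ℝ² → ℂ², and Γ^μ := I₂⊗σ^μ + Ω σ^μ⊗σ³. -/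
open MeasureTheory Complex Kronecker

noncomputable section

/-- Componentwise Moyal product of a scalar function with a vector-valued function. -/
def moyalV {n : Type*} (θ : ℝ) (a : E2 → ℂ) (Ψ : E2 → n → ℂ) : E2 → n → ℂ :=
  fun x i => moyal θ a (fun y => Ψ y i) x

/-- Partial derivative in the μ-th coordinate direction. -/
def pd {V : Type*} [NormedAddCommGroup V] [NormedSpace ℝ V] (μ : Fin 2) (f : E2 → V) :
    E2 → V := fun x => fderiv ℝ f x (EuclideanSpace.single μ (1 : ℝ))

/-- The Pauli matrices σ¹, σ². -/
def σv : Fin 2 → Matrix (Fin 2) (Fin 2) ℂ :=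
  ![!![0, 1; 1, 0], !![0, Complex.I; -Complex.I, 0]]

/-- The Pauli matrix σ³ = iσ¹σ². -/
def σ3 : Matrix (Fin 2) (Fin 2) ℂ := !![1, 0; 0, -1]

/-- `Γ^μ := I₂⊗σ^μ + Ω σ^μ⊗σ³`, the effective Clifford matrices of `D₁`. -/
def Γmat (Ω : ℝ) (μ : Fin 2) : Matrix (Fin 2 × Fin 2) (Fin 2 × Fin 2) ℂ :=
  (1 : Matrix (Fin 2) (Fin 2) ℂ) ⊗ₖ σv μ + Ω • (σv μ ⊗ₖ σ3)

theorem Real.iSup_eq_mul_iSup {ι κ : Type*} [Nonempty κ] {f : ι → ℝ} {g : κ → ℝ} {s : ℝ}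
    (hs : 0 < s) (hle : ∀ C, (∀ k, g k ≤ C) → ∀ i, f i ≤ s * C)
    (hge : ∀ k, ∃ i, f i = s * g k) : ⨆ i, f i = s * ⨆ k, g k := by
  have : Nonempty ι := (hge (Classical.arbitrary κ)).nonempty
  by_cases hg : BddAbove (Set.range g)
  · have hf := hle _ (le_ciSup hg)
    refine le_antisymm (ciSup_le hf) ?_
    rw [Real.mul_iSup_of_nonneg hs.le]
    refine ciSup_le fun k => ?_
    obtain ⟨i, hi⟩ := hge k
    exact hi ▸ le_ciSup ⟨_, Set.forall_mem_range.2 hf⟩ i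
  · have hf : ¬ BddAbove (Set.range f) := by
      rintro ⟨C, hC⟩
      refine hg ⟨C / s, Set.forall_mem_range.2 fun k => ?_⟩
      obtain ⟨i, hi⟩ := hge k
      rw [le_div_iff₀ hs, mul_comm, ← hi]
      exact hC (Set.mem_range_self i)
    rw [Real.iSup_of_not_bddAbove hf, Real.iSup_of_not_bddAbove hg, mul_zero]

/-- The partial derivative of a Schwartz function, as a Schwartz function. -/
def pdSchwartz (μ : Fin 2) (a : SchwartzMap E2 ℂ) : SchwartzMap E2 ℂ :=
  LineDeriv.lineDerivOp (EuclideanSpace.single μ (1 : ℝ)) a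

theorem coe_pdSchwartz (μ : Fin 2) (a : SchwartzMap E2 ℂ) : ⇑(pdSchwartz μ a) = pd μ ⇑a := by
  ext x
  simp [pdSchwartz, pd, SchwartzMap.lineDerivOp_apply_eq_fderiv]

/-- The oscillatory factor in the Moyal product. -/
def moyalKernel (θ : ℝ) (p : E2 × E2) : ℂ :=
  Complex.exp (-(2 * Complex.I) *
    ((((p.1 1) * (p.2 0) - (p.1 0) * (p.2 1)) / θ : ℝ) : ℂ))

theorem continuous_moyalKernel (θ : ℝ) : Continuous (moyalKernel θ) := by
  unfold moyalKernel
  fun_prop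

theorem norm_moyalKernel (θ : ℝ) (p : E2 × E2) : ‖moyalKernel θ p‖ = 1 := by
  rw [moyalKernel, Complex.norm_exp]
  simp

theorem integrable_moyal (θ : ℝ) (f g : SchwartzMap E2 ℂ) (x : E2) :
    Integrable (fun p : E2 × E2 => f (x + p.1) * g (x + p.2) * moyalKernel θ p)
      (volume.prod volume) :=
  ((f.integrable.comp_add_left x).mul_prod (g.integrable.comp_add_left x)).mul_bdd (c := 1)
    (continuous_moyalKernel θ).aestronglyMeasurable
    (.of_forall fun p => (norm_moyalKernel θ p).le)

theorem moyal_eq_integral_prod (θ : ℝ) (f g : SchwartzMap E2 ℂ) (x : E2) :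
    moyal θ f g x = (((Real.pi * θ) ^ 2)⁻¹ : ℝ) •
      ∫ p : E2 × E2, f (x + p.1) * g (x + p.2) * moyalKernel θ p ∂(volume.prod volume) := by
  rw [integral_prod _ (integrable_moyal θ f g x)]
  rfl

theorem stronglyMeasurable_moyal (θ : ℝ) (f g : SchwartzMap E2 ℂ) :
    StronglyMeasurable (moyal θ f g) := by
  have : moyal θ f g = fun x => (((Real.pi * θ) ^ 2)⁻¹ : ℝ) •
      ∫ p : E2 × E2, f (x + p.1) * g (x + p.2) * moyalKernel θ p ∂(volume.prod volume) :=
    funext (moyal_eq_integral_prod θ f g)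
  rw [this]
  have := continuous_moyalKernel θ
  have hf := f.continuous
  have hg := g.continuous
  have hF : StronglyMeasurable (Function.uncurry fun (x : E2) (p : E2 × E2) =>
      f (x + p.1) * g (x + p.2) * moyalKernel θ p) :=
    Continuous.stronglyMeasurable (by fun_prop)
  exact (hF.integral_prod_right (ν := volume.prod volume)).fun_const_smul (((Real.pi * θ) ^ 2)⁻¹ : ℝ)

theorem moyal_add_smul (θ : ℝ) (f g h : SchwartzMap E2 ℂ) (c : ℂ) (x : E2) :
    moyal θ f ⇑(g + c • h) x = moyal θ f g x + c * moyal θ f h x := by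
  simp only [moyal_eq_integral_prod]
  rw [mul_smul_comm, ← integral_const_mul, ← smul_add,
    ← integral_add (integrable_moyal θ f g x) ((integrable_moyal θ f h x).const_mul c)]
  congr 2 with p
  simp only [add_apply, smul_apply, smul_eq_mul]
  ring

/-- A component of a vector-valued Schwartz function. -/
def component {n : Type*} [Fintype n] (Ψ : SchwartzMap E2 (n → ℂ)) (i : n) : SchwartzMap E2 ℂ :=
  SchwartzMap.postcompCLM (ContinuousLinearMap.proj (R := ℂ) (φ := fun _ : n => ℂ) i) Ψ

/-- The spinor with the two given components. -/
def spinor (f g : SchwartzMap E2 ℂ) : SchwartzMap E2 (Fin 2 → ℂ) :=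
  SchwartzMap.postcompCLM (ContinuousLinearMap.single ℂ (fun _ : Fin 2 => ℂ) 0) f +
    SchwartzMap.postcompCLM (ContinuousLinearMap.single ℂ (fun _ : Fin 2 => ℂ) 1) g

theorem spinor_zero (f g : SchwartzMap E2 ℂ) : (fun y => spinor f g y 0) = f := by
  ext y; simp [spinor]

theorem spinor_one (f g : SchwartzMap E2 ℂ) : (fun y => spinor f g y 1) = g := by
  ext y; simp [spinor]

/-- The embedding `(f, g) ↦ (f, 0, 0, g)` of `ℂ²`-valued into `ℂ⁴`-valued functions. -/
def diagonalSpinor (Ψ : SchwartzMap E2 (Fin 2 → ℂ)) : SchwartzMap E2 (Fin 2 × Fin 2 → ℂ) :=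
  SchwartzMap.postcompCLM (ContinuousLinearMap.pi fun i : Fin 2 × Fin 2 =>
    if i.1 = i.2 then ContinuousLinearMap.proj (R := ℂ) (φ := fun _ : Fin 2 => ℂ) i.1 else 0) Ψ

theorem diagonalSpinor_apply (Ψ : SchwartzMap E2 (Fin 2 → ℂ)) (y : E2) (i j : Fin 2) :
    diagonalSpinor Ψ y (i, j) = if i = j then Ψ y i else 0 := by
  by_cases h : i = j <;> simp [diagonalSpinor, h]

theorem moyal_zero_right (θ : ℝ) (f : E2 → ℂ) (x : E2) : moyal θ f (fun _ => 0) x = 0 := by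
  simp [moyal]

/-- The squared pointwise norm of a spinor. -/
def density {n : Type*} [Fintype n] (Ψ : E2 → n → ℂ) (x : E2) : ℝ := ∑ i, ‖Ψ x i‖ ^ 2

/-- Up to a phase, the commutator of `D₀` with `a`, applied to a spinor. -/
def dirac₀ (θ : ℝ) (a : E2 → ℂ) (Ψ : E2 → Fin 2 → ℂ) (x : E2) : Fin 2 → ℂ :=
  ∑ μ : Fin 2, (σv μ).mulVec (moyalV θ (pd μ a) Ψ x)

/-- Up to a phase, the commutator of `D₁` with `a`, applied to a spinor. -/
def dirac₁ (θ Ω : ℝ) (a : E2 → ℂ) (Ψ : E2 → Fin 2 × Fin 2 → ℂ) (x : E2) : Fin 2 × Fin 2 → ℂ :=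
  ∑ μ : Fin 2, (Γmat Ω μ).mulVec (moyalV θ (pd μ a) Ψ x)

theorem density_nonneg {n : Type*} [Fintype n] (Ψ : E2 → n → ℂ) (x : E2) : 0 ≤ density Ψ x := by
  unfold density; positivity

theorem integrable_density {n : Type*} [Fintype n] (Ψ : SchwartzMap E2 (n → ℂ)) :
    Integrable (density Ψ) := by
  refine integrable_finsetSum _ fun i _ => ?_
  exact ((component Ψ i).memLp 2).integrable_norm_pow (by norm_num)

theorem eq_zero_of_integral_density_eq_zero {n : Type*} [Fintype n] (Ψ : SchwartzMap E2 (n → ℂ))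
    (h : ∫ x, density Ψ x = 0) : Ψ = 0 := by
  rw [integral_eq_zero_iff_of_nonneg (density_nonneg Ψ) (integrable_density Ψ)] at h
  have hc : Continuous (density Ψ) := by
    have := Ψ.continuous
    unfold density
    fun_prop
  have h : density Ψ = 0 := (hc.ae_eq_iff_eq volume continuous_zero).1 h
  ext x i
  have hx : density Ψ x = 0 := congrFun h x
  rw [density, Finset.sum_eq_zero_iff_of_nonneg (fun _ _ => by positivity)] at hx
  simpa using hx i (Finset.mem_univ i)

theorem density_zero {n : Type*} [Fintype n] :
    density (0 : E2 → n → ℂ) = 0 := by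
  ext x
  simp [density]

theorem dirac₀_zero (θ : ℝ) (a : E2 → ℂ) (x : E2) :
    dirac₀ θ a 0 x = 0 := by
  have h : ∀ μ, moyalV θ (pd μ a) (0 : E2 → Fin 2 → ℂ) x = 0 := fun μ =>
    funext fun i => moyal_zero_right θ _ x
  simp only [dirac₀, h, Matrix.mulVec_zero, Finset.sum_const_zero]

theorem stronglyMeasurable_density_dirac₀ (θ : ℝ) (a : SchwartzMap E2 ℂ)
    (Ψ : SchwartzMap E2 (Fin 2 → ℂ)) : StronglyMeasurable (density (dirac₀ θ a Ψ)) := by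
  have h (μ i : Fin 2) : StronglyMeasurable fun x => moyalV θ (pd μ a) Ψ x i := by
    rw [← coe_pdSchwartz]
    exact stronglyMeasurable_moyal θ _ (component Ψ i)
  unfold density dirac₀ Matrix.mulVec dotProduct
  simp only [Finset.sum_apply]
  refine Finset.stronglyMeasurable_fun_sum _ fun i _ => (StronglyMeasurable.norm ?_).pow 2
  exact Finset.stronglyMeasurable_fun_sum _ fun μ _ =>
    Finset.stronglyMeasurable_fun_sum _ fun j _ => (h μ j).const_mul _

/-- Rotating the off-diagonal components decouples `D₁` into two copies of `D₀`. -/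
def rotatedSpinor (Ω : ℝ) (Ψ : SchwartzMap E2 (Fin 2 × Fin 2 → ℂ)) : SchwartzMap E2 (Fin 2 → ℂ) :=
  spinor (component Ψ (1, 0) + (-Ω : ℂ) • component Ψ (0, 1))
    (component Ψ (0, 1) + (Ω : ℂ) • component Ψ (1, 0))

/-- The diagonal components of a `ℂ⁴`-valued function. -/
def diagonalPart (Ψ : SchwartzMap E2 (Fin 2 × Fin 2 → ℂ)) : SchwartzMap E2 (Fin 2 → ℂ) :=
  spinor (component Ψ (0, 0)) (component Ψ (1, 1))

theorem density_dirac₁ (θ Ω : ℝ) (a : SchwartzMap E2 ℂ) (Ψ : SchwartzMap E2 (Fin 2 × Fin 2 → ℂ))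
    (x : E2) : density (dirac₁ θ Ω a Ψ) x =
      density (dirac₀ θ a (rotatedSpinor Ω Ψ)) x +
        (1 + Ω ^ 2) * density (dirac₀ θ a (diagonalPart Ψ)) x := by
  have h (i : Fin 2 × Fin 2) : (fun y => Ψ y i) = component Ψ i := rfl
  simp only [density, dirac₀, dirac₁, moyalV, rotatedSpinor, diagonalPart, Matrix.mulVec,
    dotProduct, Fintype.sum_prod_type, Fin.sum_univ_two, Pi.add_apply, spinor_zero, spinor_one, h,
    ← coe_pdSchwartz, moyal_add_smul]
  simp only [Complex.sq_norm, Complex.normSq_apply]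
  simp [Γmat, σv, σ3]
  ring

theorem density_eq (Ω : ℝ) (Ψ : SchwartzMap E2 (Fin 2 × Fin 2 → ℂ)) (x : E2) :
    (1 + Ω ^ 2) * density Ψ x =
      density (rotatedSpinor Ω Ψ) x + (1 + Ω ^ 2) * density (diagonalPart Ψ) x := by
  have h (i : Fin 2 × Fin 2) : component Ψ i x = Ψ x i := rfl
  have h₀ (f g : SchwartzMap E2 ℂ) : spinor f g x 0 = f x := congrFun (spinor_zero f g) x
  have h₁ (f g : SchwartzMap E2 ℂ) : spinor f g x 1 = g x := congrFun (spinor_one f g) x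
  simp only [density, rotatedSpinor, diagonalPart, Fintype.sum_prod_type, Fin.sum_univ_two, h₀, h₁,
    add_apply, smul_apply, h, Complex.sq_norm, Complex.normSq_apply]
  simp
  ring

theorem density_diagonalSpinor (Ψ : SchwartzMap E2 (Fin 2 → ℂ)) :
    density (diagonalSpinor Ψ) = density Ψ := by
  ext x
  simp [density, Fintype.sum_prod_type, Fin.sum_univ_two, diagonalSpinor_apply]

theorem density_dirac₁_diagonalSpinor (θ Ω : ℝ) (a : SchwartzMap E2 ℂ)
    (Ψ : SchwartzMap E2 (Fin 2 → ℂ)) (x : E2) :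
    density (dirac₁ θ Ω a (diagonalSpinor Ψ)) x = (1 + Ω ^ 2) * density (dirac₀ θ a Ψ) x := by
  have h₁ : rotatedSpinor Ω (diagonalSpinor Ψ) = 0 := by
    ext y i
    fin_cases i <;>
      simp [rotatedSpinor, spinor, component, diagonalSpinor_apply]
  have h₂ : diagonalPart (diagonalSpinor Ψ) = Ψ := by
    ext y i
    fin_cases i <;>
      simp [diagonalPart, spinor, component, diagonalSpinor_apply]
  rw [density_dirac₁, h₁, h₂]
  simp [density, dirac₀_zero]

theorem integral_density_dirac₀_le {θ C : ℝ} {a : SchwartzMap E2 ℂ}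
    (hC : ∀ Ψ : SchwartzMap E2 (Fin 2 → ℂ),
      √(∫ x, density (dirac₀ θ a Ψ) x) / √(∫ x, density Ψ x) ≤ C)
    (Ψ : SchwartzMap E2 (Fin 2 → ℂ)) :
    ∫ x, density (dirac₀ θ a Ψ) x ≤ C ^ 2 * ∫ x, density Ψ x := by
  have hD : 0 ≤ ∫ x, density Ψ x := integral_nonneg (density_nonneg _)
  rcases hD.eq_or_lt with h | h
  · rw [eq_zero_of_integral_density_eq_zero Ψ h.symm]
    simp [density, dirac₀_zero]
  · have hC₀ : 0 ≤ C := le_trans (by positivity) (hC Ψ)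
    have := hC Ψ
    rw [div_le_iff₀ (Real.sqrt_pos.2 h), Real.sqrt_le_left (by positivity), mul_pow,
      Real.sq_sqrt hD] at this
    exact this

theorem integral_density_dirac₁_le {θ C : ℝ} (Ω : ℝ) {a : SchwartzMap E2 ℂ}
    (hC : ∀ Ψ : SchwartzMap E2 (Fin 2 → ℂ),
      √(∫ x, density (dirac₀ θ a Ψ) x) / √(∫ x, density Ψ x) ≤ C)
    (Ψ : SchwartzMap E2 (Fin 2 × Fin 2 → ℂ)) :
    ∫ x, density (dirac₁ θ Ω a Ψ) x ≤ (1 + Ω ^ 2) * C ^ 2 * ∫ x, density Ψ x := by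
  have hs : 0 < 1 + Ω ^ 2 := by positivity
  by_cases hi : Integrable (density (dirac₁ θ Ω a Ψ))
  · have hm := stronglyMeasurable_density_dirac₀ θ a
    have hn := fun Ψ : SchwartzMap E2 (Fin 2 → ℂ) => density_nonneg (dirac₀ θ a Ψ)
    have h₁ : Integrable (density (dirac₀ θ a (rotatedSpinor Ω Ψ))) := by
      refine hi.mono' (hm _).aestronglyMeasurable (.of_forall fun x => ?_)
      rw [Real.norm_of_nonneg (hn _ x), density_dirac₁]
      have := mul_nonneg hs.le (hn (diagonalPart Ψ) x)
      linarith
    have h₂ : Integrable fun x => (1 + Ω ^ 2) * density (dirac₀ θ a (diagonalPart Ψ)) x := by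
      refine hi.mono' ((hm _).const_mul _).aestronglyMeasurable (.of_forall fun x => ?_)
      rw [Real.norm_of_nonneg (mul_nonneg hs.le (hn _ x)), density_dirac₁]
      linarith [hn (rotatedSpinor Ω Ψ) x]
    have hsum : (1 + Ω ^ 2) * ∫ x, density Ψ x = (∫ x, density (rotatedSpinor Ω Ψ) x) +
        (1 + Ω ^ 2) * ∫ x, density (diagonalPart Ψ) x := by
      rw [← integral_const_mul, ← integral_const_mul, ← integral_add (integrable_density _)
        ((integrable_density _).const_mul _)]
      exact integral_congr_ae (.of_forall (density_eq Ω Ψ))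
    rw [integral_congr_ae (.of_forall (density_dirac₁ θ Ω a Ψ)), integral_add h₁ h₂,
      integral_const_mul]
    have k₁ := integral_density_dirac₀_le hC (rotatedSpinor Ω Ψ)
    have k₂ := mul_le_mul_of_nonneg_left (integral_density_dirac₀_le hC (diagonalPart Ψ)) hs.le
    linear_combination k₁ + k₂ - C ^ 2 * hsum
  · rw [integral_undef hi]
    have : 0 ≤ ∫ x, density Ψ x := integral_nonneg (density_nonneg Ψ)
    positivity

theorem iSup_ne_zero_ratio {n : Type*} [Fintype n] (N : SchwartzMap E2 (n → ℂ) → ℝ) :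
    (⨆ (Ψ : SchwartzMap E2 (n → ℂ)) (_ : Ψ ≠ 0), N Ψ / √(∫ x, density Ψ x)) =
      ⨆ Ψ : SchwartzMap E2 (n → ℂ), N Ψ / √(∫ x, density Ψ x) := by
  congr 1 with Ψ
  by_cases h : Ψ = 0
  · simp [h, density_zero]
  · simp [h]

/-- The Lipschitz seminorm of `a` for the harmonic Dirac operator `D₁` equals
`√(1+Ω²)` times that for the standard Dirac operator `D₀`. -/
theorem lipschitz_D1_eq (θ : ℝ) (hθ : 0 < θ) (Ω : ℝ) (hΩ : Ω ∈ Set.Ioc (0:ℝ) 1)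
    (a : SchwartzMap E2 ℂ) :
    (⨆ (Ψ : SchwartzMap E2 (Fin 2 × Fin 2 → ℂ)) (_ : Ψ ≠ 0),
        Real.sqrt (∫ x : E2, ∑ i : Fin 2 × Fin 2,
            ‖(∑ μ : Fin 2, (Γmat Ω μ).mulVec (moyalV θ (pd μ (⇑a)) (⇑Ψ) x)) i‖ ^ 2) /
          Real.sqrt (∫ x : E2, ∑ i : Fin 2 × Fin 2, ‖Ψ x i‖ ^ 2))
      = Real.sqrt (1 + Ω ^ 2) *
        (⨆ (Ψ' : SchwartzMap E2 (Fin 2 → ℂ)) (_ : Ψ' ≠ 0),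
          Real.sqrt (∫ x : E2, ∑ i : Fin 2,
              ‖(∑ μ : Fin 2, (σv μ).mulVec (moyalV θ (pd μ (⇑a)) (⇑Ψ') x)) i‖ ^ 2) /
            Real.sqrt (∫ x : E2, ∑ i : Fin 2, ‖Ψ' x i‖ ^ 2)) := by
  have hs : 0 < 1 + Ω ^ 2 := by positivity
  refine (iSup_ne_zero_ratio fun Ψ => √(∫ x, density (dirac₁ θ Ω a Ψ) x)).trans (Eq.trans ?_
    (congrArg _ (iSup_ne_zero_ratio fun Ψ => √(∫ x, density (dirac₀ θ a Ψ) x)).symm))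
  refine Real.iSup_eq_mul_iSup (Real.sqrt_pos.2 hs) (fun C hC Ψ => ?_) fun Ψ =>
    ⟨diagonalSpinor Ψ, ?_⟩
  · have hC₀ : 0 ≤ C := le_trans (by positivity) (hC 0)
    refine div_le_of_le_mul₀ (Real.sqrt_nonneg _) (by positivity) ?_
    refine (Real.sqrt_le_sqrt (integral_density_dirac₁_le Ω hC Ψ)).trans_eq ?_
    rw [Real.sqrt_mul (by positivity), Real.sqrt_mul hs.le, Real.sqrt_sq hC₀]
  · simp only [density_dirac₁_diagonalSpinor, density_diagonalSpinor, integral_const_mul]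
    rw [Real.sqrt_mul hs.le, mul_div_assoc]

end
end
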